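/- The assignment E_i ↦ Σ_{r=−i}^{i−1} w_i^r, F_{θ(i)} ↦ Σ_{r=−i}^{i−1} m_i^r, K_i ↦ q^{2i} X_{V_{i,−i}} X_{V_{i,1−i}} ⋯ X_{V_{i,i}}, K'_{θ(i)} ↦ q^{2i} X_{Λ_{i,−i}} X_{Λ_{i,1−i}} ⋯ X_{Λ_{i,i}} (1 ≤ i ≤ n), with K_i^{−1}, (K_i')^{−1} sent to the inverses of the images of K_i, K_i', extends to a homomorphism of 𝕂-algebras ι : 𝔇_n → 𝒟_n; that is, these images satisfy all the defining relations of 𝔇_n. -/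

import Mathlib

noncomputable section

/-- The ground field `𝕂 = ℂ(q)`, the field of rational functions over `ℂ`. -/
abbrev Kq : Type := RatFunc ℂ

/-- The formal variable `q ∈ ℂ(q)`. -/
def qq : Kq := RatFunc.X

/-- `𝐢 = √−1 ∈ ℂ`, viewed as a constant in `𝕂 = ℂ(q)`. -/
def ii : Kq := RatFunc.C Complex.I

/-- `θ(i) = n + 1 − i`. -/
def th (n : ℕ) (i : ℤ) : ℤ := (n : ℤ) + 1 - i

/-- Labels for the vertices of the `𝒟ₙ`-quiver: `V i r` stands for `V_{i,r}`
(the canonical labels), and `C i` stands for the central vertex `Λ_{i,0}`. -/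
inductive DnLabel : Type
  | V : ℤ → ℤ → DnLabel
  | C : ℤ → DnLabel
deriving DecidableEq

/-- Validity of a label for given rank `n`: `V i r` requires `1 ≤ i ≤ n`, `−i ≤ r ≤ i`;
`C i` requires `1 ≤ i ≤ n`.  There are `n² + 3n` valid labels. -/
def DnLabel.valid (n : ℕ) : DnLabel → Prop
  | .V i r => 1 ≤ i ∧ i ≤ (n : ℤ) ∧ -i ≤ r ∧ r ≤ i
  | .C i => 1 ≤ i ∧ i ≤ (n : ℤ)

instance (n : ℕ) (v : DnLabel) : Decidable (v.valid n) := by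
  cases v <;> unfold DnLabel.valid <;> infer_instance

/-- The vertex set of the `𝒟ₙ`-quiver. -/
def DnVertex (n : ℕ) := {v : DnLabel // v.valid n}

/-- The canonical label of the vertex `Λ_{i,r}`, using the identifications
`Λ_{a,b} = V_{θ(b),−θ(a)}` for `b > 0` and `Λ_{a,b} = V_{θ(−b),θ(a)}` for `b < 0`. -/
def Lam (n : ℕ) (i r : ℤ) : DnLabel :=
  if 0 < r then .V (th n r) (-(th n i))
  else if r < 0 then .V (th n (-r)) (th n i)
  else .C i

/-- The list of arrows `(source, target, doubled weight)` of the `𝒟ₙ`-quiver, obtained by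
amalgamating two copies of the Fock–Goncharov `(n+1)`-triangle quiver along two pairs of
sides.  Solid (weight `1`) arrows get doubled weight `2`, dashed (weight `1/2`) arrows get
doubled weight `1`.  The families are: the horizontal `V_i`- and `Λ_i`-path arrows, the
dashed boundary arrows along the two frozen columns, and, for each `1 ≤ i < n`, the
oriented cycle `V_{i,0} → V_{i+1,−1} → ⋯ → V_{n,i−n} → Λ_{i,0} → V_{n,n−i} → ⋯ → V_{i+1,1} → V_{i,0}`
through the central column. -/
def dnArrows (n : ℕ) : List (DnLabel × DnLabel × ℤ) :=
  ((List.range n).flatMap fun i0 =>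
    (List.range (2 * i0 + 2)).map fun k =>
      (DnLabel.V ((i0 : ℤ) + 1) (-((i0 : ℤ) + 1) + k),
       DnLabel.V ((i0 : ℤ) + 1) (-((i0 : ℤ) + 1) + k + 1), 2))
  ++ ((List.range n).flatMap fun i0 =>
    (List.range (2 * i0 + 2)).map fun k =>
      (Lam n ((i0 : ℤ) + 1) (-((i0 : ℤ) + 1) + k),
       Lam n ((i0 : ℤ) + 1) (-((i0 : ℤ) + 1) + k + 1), 2))
  ++ ((List.range (n - 1)).map fun i0 =>
      (DnLabel.V ((i0 : ℤ) + 1) (-((i0 : ℤ) + 1)),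
       DnLabel.V ((i0 : ℤ) + 2) (-((i0 : ℤ) + 2)), 1))
  ++ ((List.range (n - 1)).map fun i0 =>
      (DnLabel.V ((i0 : ℤ) + 2) ((i0 : ℤ) + 2),
       DnLabel.V ((i0 : ℤ) + 1) ((i0 : ℤ) + 1), 1))
  ++ ((List.range (n - 1)).flatMap fun i0 =>
      (((List.range (n - 1 - i0)).map fun k =>
          (DnLabel.V ((i0 : ℤ) + 1 + k) (-(k : ℤ)),
           DnLabel.V ((i0 : ℤ) + 2 + k) (-(k : ℤ) - 1), 2))
        ++ [(DnLabel.V (n : ℤ) ((i0 : ℤ) + 1 - n), DnLabel.C ((i0 : ℤ) + 1), 2),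
            (DnLabel.C ((i0 : ℤ) + 1), DnLabel.V (n : ℤ) ((n : ℤ) - (i0 + 1)), 2)]
        ++ ((List.range (n - 1 - i0)).map fun k =>
          (DnLabel.V ((i0 : ℤ) + 2 + k) ((k : ℤ) + 1),
           DnLabel.V ((i0 : ℤ) + 1 + k) (k : ℤ), 2))))

/-- The doubled exchange matrix `2·ε_{uv}` of the `𝒟ₙ`-quiver. -/
def eps2 (n : ℕ) (u v : DnLabel) : ℤ :=
  ((dnArrows n).map fun a =>
    (if a.1 = u ∧ a.2.1 = v then a.2.2 else 0)
      - (if a.1 = v ∧ a.2.1 = u then a.2.2 else 0)).sum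

/-- The defining relations of the quantum torus algebra `𝒟ₙ`: generators `X_v^{±1}`
(`Sum.inl v` is `X_v`, `Sum.inr v` is `X_v⁻¹`) with `X_u X_v = q^{2 ε_{vu}} X_v X_u`. -/
inductive DnRel (n : ℕ) :
    FreeAlgebra Kq (DnVertex n ⊕ DnVertex n) →
      FreeAlgebra Kq (DnVertex n ⊕ DnVertex n) → Prop
  | comm (u v : DnVertex n) :
      DnRel n (FreeAlgebra.ι Kq (Sum.inl u) * FreeAlgebra.ι Kq (Sum.inl v))
        ((qq ^ eps2 n v.1 u.1) • (FreeAlgebra.ι Kq (Sum.inl v) * FreeAlgebra.ι Kq (Sum.inl u)))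
  | mul_inv (v : DnVertex n) :
      DnRel n (FreeAlgebra.ι Kq (Sum.inl v) * FreeAlgebra.ι Kq (Sum.inr v)) 1
  | inv_mul (v : DnVertex n) :
      DnRel n (FreeAlgebra.ι Kq (Sum.inr v) * FreeAlgebra.ι Kq (Sum.inl v)) 1

/-- The quantum torus algebra `𝒟ₙ`. -/
abbrev Dtorus (n : ℕ) := RingQuot (DnRel n)

/-- The cluster variable `X_v ∈ 𝒟ₙ` attached to a label (junk value `1` on invalid labels). -/
def Xg (n : ℕ) (v : DnLabel) : Dtorus n :=
  if h : v.valid n then RingQuot.mkAlgHom Kq (DnRel n) (FreeAlgebra.ι Kq (Sum.inl ⟨v, h⟩)) else 1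

/-- The inverse cluster variable `X_v⁻¹ ∈ 𝒟ₙ` (junk value `1` on invalid labels). -/
def Xinv (n : ℕ) (v : DnLabel) : Dtorus n :=
  if h : v.valid n then RingQuot.mkAlgHom Kq (DnRel n) (FreeAlgebra.ι Kq (Sum.inr ⟨v, h⟩)) else 1

/-- The ordered product `X_{V_{i,−i}} X_{V_{i,1−i}} ⋯ X_{V_{i,r}}`. -/
def Vprod (n : ℕ) (i r : ℤ) : Dtorus n :=
  ((List.range (r + i + 1).toNat).map fun k => Xg n (.V i (-i + k))).prod

/-- The ordered product `X_{Λ_{i,−i}} X_{Λ_{i,1−i}} ⋯ X_{Λ_{i,r}}`. -/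
def Lprod (n : ℕ) (i r : ℤ) : Dtorus n :=
  ((List.range (r + i + 1).toNat).map fun k => Xg n (Lam n i (-i + k))).prod

/-- `w_i^r = 𝐢 q^{i+r} X_{V_{i,−i}} X_{V_{i,1−i}} ⋯ X_{V_{i,r}}`. -/
def ww (n : ℕ) (i r : ℤ) : Dtorus n := (ii * qq ^ (i + r)) • Vprod n i r

/-- `m_i^r = 𝐢 q^{i+r} X_{Λ_{i,−i}} X_{Λ_{i,1−i}} ⋯ X_{Λ_{i,r}}`. -/
def mm (n : ℕ) (i r : ℤ) : Dtorus n := (ii * qq ^ (i + r)) • Lprod n i r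


/-- Index set `{1, …, n} ⊂ ℤ`. -/
def Idx (n : ℕ) := {i : ℤ // 1 ≤ i ∧ i ≤ (n : ℤ)}

/-- `θ` as a map on the index set. -/
def thIdx (n : ℕ) (i : Idx n) : Idx n :=
  ⟨th n i.1, by obtain ⟨h1, h2⟩ := i.2; unfold th; constructor <;> omega⟩

/-- Generators of the Drinfeld double `𝔇ₙ`. -/
inductive DDGen (n : ℕ) : Type
  | E : Idx n → DDGen n
  | F : Idx n → DDGen n
  | K : Idx n → DDGen n
  | K' : Idx n → DDGen n
  | Kinv : Idx n → DDGen n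
  | K'inv : Idx n → DDGen n

/-- The Cartan matrix of type `Aₙ`. -/
def cartanA (i j : ℤ) : ℤ := if i = j then 2 else if (i - j).natAbs = 1 then -1 else 0

/-- Shorthand for the generators inside the free algebra. -/
def ddg (n : ℕ) (g : DDGen n) : FreeAlgebra Kq (DDGen n) := FreeAlgebra.ι Kq g

/-- The defining relations of the Drinfeld double `𝔇ₙ`. -/
inductive DDRel (n : ℕ) : FreeAlgebra Kq (DDGen n) → FreeAlgebra Kq (DDGen n) → Prop
  | KE (i j : Idx n) : DDRel n (ddg n (.K i) * ddg n (.E j))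
      ((qq ^ cartanA i.1 j.1) • (ddg n (.E j) * ddg n (.K i)))
  | K'E (i j : Idx n) : DDRel n (ddg n (.K' i) * ddg n (.E j))
      ((qq ^ (-cartanA i.1 j.1)) • (ddg n (.E j) * ddg n (.K' i)))
  | KF (i j : Idx n) : DDRel n (ddg n (.K i) * ddg n (.F j))
      ((qq ^ (-cartanA i.1 j.1)) • (ddg n (.F j) * ddg n (.K i)))
  | K'F (i j : Idx n) : DDRel n (ddg n (.K' i) * ddg n (.F j))
      ((qq ^ cartanA i.1 j.1) • (ddg n (.F j) * ddg n (.K' i)))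
  | KK (i j : Idx n) : DDRel n (ddg n (.K i) * ddg n (.K j)) (ddg n (.K j) * ddg n (.K i))
  | KK' (i j : Idx n) : DDRel n (ddg n (.K i) * ddg n (.K' j)) (ddg n (.K' j) * ddg n (.K i))
  | K'K' (i j : Idx n) : DDRel n (ddg n (.K' i) * ddg n (.K' j)) (ddg n (.K' j) * ddg n (.K' i))
  | K_Kinv (i : Idx n) : DDRel n (ddg n (.K i) * ddg n (.Kinv i)) 1
  | Kinv_K (i : Idx n) : DDRel n (ddg n (.Kinv i) * ddg n (.K i)) 1
  | K'_K'inv (i : Idx n) : DDRel n (ddg n (.K' i) * ddg n (.K'inv i)) 1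
  | K'inv_K' (i : Idx n) : DDRel n (ddg n (.K'inv i) * ddg n (.K' i)) 1
  | EF (i j : Idx n) : DDRel n (ddg n (.E i) * ddg n (.F j))
      (ddg n (.F j) * ddg n (.E i)
        + (if i.1 = j.1 then qq - qq⁻¹ else 0) • (ddg n (.K i) - ddg n (.K' i)))
  | serreE (i j : Idx n) (h : (i.1 - j.1).natAbs = 1) :
      DDRel n (ddg n (.E i) * ddg n (.E i) * ddg n (.E j)
          + ddg n (.E j) * (ddg n (.E i) * ddg n (.E i)))
        ((qq + qq⁻¹) • (ddg n (.E i) * ddg n (.E j) * ddg n (.E i)))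
  | serreF (i j : Idx n) (h : (i.1 - j.1).natAbs = 1) :
      DDRel n (ddg n (.F i) * ddg n (.F i) * ddg n (.F j)
          + ddg n (.F j) * (ddg n (.F i) * ddg n (.F i)))
        ((qq + qq⁻¹) • (ddg n (.F i) * ddg n (.F j) * ddg n (.F i)))
  | EEc (i j : Idx n) (h : 1 < (i.1 - j.1).natAbs) :
      DDRel n (ddg n (.E i) * ddg n (.E j)) (ddg n (.E j) * ddg n (.E i))
  | FFc (i j : Idx n) (h : 1 < (i.1 - j.1).natAbs) :
      DDRel n (ddg n (.F i) * ddg n (.F j)) (ddg n (.F j) * ddg n (.F i))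

/-- The Drinfeld double `𝔇ₙ` of the quantum Borel subalgebra of `U_q(sl_{n+1})`. -/
abbrev DDalg (n : ℕ) := RingQuot (DDRel n)

/-- The generators of `𝔇ₙ`. -/
def DDgen (n : ℕ) (g : DDGen n) : DDalg n := RingQuot.mkAlgHom Kq (DDRel n) (ddg n g)

/-- The defining property of the embedding `ι : 𝔇ₙ → 𝒟ₙ`:
`ι(E_i) = Σ_{r=−i}^{i−1} w_i^r`, `ι(K_i) = q^{2i} X_{V_{i,−i}} ⋯ X_{V_{i,i}}`,
`ι(F_{θ(i)}) = Σ_{r=−i}^{i−1} m_i^r`, `ι(K'_{θ(i)}) = q^{2i} X_{Λ_{i,−i}} ⋯ X_{Λ_{i,i}}`,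
and `K_i^{−1}`, `(K_i')^{−1}` are sent to the inverses of the images of `K_i`, `K_i'`. -/
def iotaSpec (n : ℕ) (f : DDalg n →ₐ[Kq] Dtorus n) : Prop :=
  ∀ i : Idx n,
    f (DDgen n (.E i)) = ∑ r ∈ Finset.Icc (-i.1) (i.1 - 1), ww n i.1 r ∧
    f (DDgen n (.K i)) = (qq ^ (2 * i.1)) • Vprod n i.1 i.1 ∧
    f (DDgen n (.F (thIdx n i))) = ∑ r ∈ Finset.Icc (-i.1) (i.1 - 1), mm n i.1 r ∧
    f (DDgen n (.K' (thIdx n i))) = (qq ^ (2 * i.1)) • Lprod n i.1 i.1 ∧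
    f (DDgen n (.Kinv i)) * f (DDgen n (.K i)) = 1 ∧
    f (DDgen n (.K i)) * f (DDgen n (.Kinv i)) = 1 ∧
    f (DDgen n (.K'inv i)) * f (DDgen n (.K' i)) = 1 ∧
    f (DDgen n (.K' i)) * f (DDgen n (.K'inv i)) = 1


/-! ### The exchange matrix in closed form -/

lemma List.sum_map_range_ite {N : ℕ} {p : ℕ → Prop} [DecidablePred p] {P : Prop} [Decidable P]
    (c : ℤ) (k₀ : ℕ) (h : ∀ k < N, p k → P ∧ k = k₀) (h' : P → k₀ < N ∧ p k₀) :
    ((List.range N).map fun k => if p k then c else 0).sum = if P then c else 0 := by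
  change ∑ k ∈ Finset.range N, (if p k then c else 0) = _
  split_ifs with hP
  · rw [Finset.sum_eq_single_of_mem k₀ (Finset.mem_range.2 (h' hP).1), if_pos (h' hP).2]
    exact fun k hk hne => if_neg fun hpk => hne (h k (Finset.mem_range.1 hk) hpk).2
  · exact Finset.sum_eq_zero fun k hk => if_neg fun hpk => hP (h k (Finset.mem_range.1 hk) hpk).1

lemma List.sum_flatMap_range_ite {N : ℕ} {M : ℕ → ℕ} {p : ℕ → ℕ → Prop}
    [∀ i, DecidablePred (p i)] {P : Prop} [Decidable P] (c : ℤ) (i₀ k₀ : ℕ)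
    (h : ∀ i < N, ∀ k < M i, p i k → P ∧ i = i₀ ∧ k = k₀)
    (h' : P → i₀ < N ∧ k₀ < M i₀ ∧ p i₀ k₀) :
    ((List.range N).flatMap fun i =>
      (List.range (M i)).map fun k => if p i k then c else 0).sum = if P then c else 0 := by
  classical
  rw [List.flatMap, List.sum_flatten, List.map_map,
    ← List.sum_map_range_ite (p := fun i => i = i₀ ∧ P) c i₀ (fun i _ hi => ⟨hi.2, hi.1⟩)
      fun hP => ⟨(h' hP).1, rfl, hP⟩]
  refine congrArg List.sum (List.map_congr_left fun i hi => ?_)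
  refine List.sum_map_range_ite c k₀ (fun k hk hpk => ?_) ?_
  · obtain ⟨hP, hi', hk'⟩ := h i (List.mem_range.1 hi) k hk hpk
    exact ⟨⟨hi', hP⟩, hk'⟩
  · rintro ⟨rfl, hP⟩
    exact (h' hP).2

/-- The doubled total weight of the arrows `u → v` of the `𝒟ₙ`-quiver. -/
def arrowWeight (n : ℕ) (u v : DnLabel) : ℤ :=
  ((dnArrows n).map fun a => if a.1 = u ∧ a.2.1 = v then a.2.2 else 0).sum

lemma eps2_eq_sub (n : ℕ) (u v : DnLabel) :
    eps2 n u v = arrowWeight n u v - arrowWeight n v u := by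
  unfold eps2 arrowWeight
  induction dnArrows n with
  | nil => rfl
  | cons a l ih =>
    simp only [List.map_cons, List.sum_cons, ih]
    ring

lemma Lam_eq_V_iff {n : ℕ} {a b i r : ℤ} (ha : a ≤ n) :
    Lam n a b = .V i r ↔
      (0 < b ∧ b = n + 1 - i ∧ a = n + 1 + r) ∨ (b < 0 ∧ b = i - n - 1 ∧ a = n + 1 - r) := by
  unfold Lam th
  split_ifs <;> simp <;> omega

lemma Lam_eq_C_iff {n : ℕ} {a b i : ℤ} : Lam n a b = .C i ↔ b = 0 ∧ a = i := by
  unfold Lam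
  split_ifs <;> simp <;> omega

/-- The weight of the arrows `u → v`, in closed form. -/
def arrowForm (n : ℤ) : DnLabel → DnLabel → ℤ
  | .V i r, .V j s =>
      (if i = j ∧ s = r + 1 then 2 else 0)
      + (if (j = i - 1 ∧ s = r ∧ r < 0) ∨ (j = i + 1 ∧ s = r ∧ 0 < r) then 2 else 0)
      + (if j = i + 1 ∧ r = -i ∧ s = -j then 1 else 0)
      + (if j = i - 1 ∧ r = i ∧ s = j then 1 else 0)
      + ((if j = i + 1 ∧ s = r - 1 ∧ r ≤ 0 ∧ -i < r then 2 else 0)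
        + (if j = i - 1 ∧ s = r - 1 ∧ 0 ≤ s ∧ s < j then 2 else 0))
  | .V i r, .C a =>
      (if i = n ∧ r = n + 1 - a then 2 else 0) + (if a < n ∧ i = n ∧ r = a - n then 2 else 0)
  | .C a, .V j s =>
      (if j = n ∧ s = a - n - 1 then 2 else 0) + (if a < n ∧ j = n ∧ s = n - a then 2 else 0)
  | .C _, .C _ => 0

lemma sum_horizontal_arrows {n : ℕ} {u v : DnLabel} (hu : u.valid n) (hv : v.valid n) :
    ((List.range n).flatMap fun i0 => (List.range (2 * i0 + 2)).map fun k =>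
      if DnLabel.V ((i0 : ℤ) + 1) (-((i0 : ℤ) + 1) + (k : ℕ)) = u ∧
        DnLabel.V ((i0 : ℤ) + 1) (-((i0 : ℤ) + 1) + (k : ℕ) + 1) = v then (2 : ℤ) else 0).sum =
    match u, v with
    | .V i r, .V j s => if i = j ∧ s = r + 1 then 2 else 0
    | _, _ => 0 := by
  rcases u with ⟨i, r⟩ | a <;> rcases v with ⟨j, s⟩ | b <;> simp only [DnLabel.valid] at hu hv
  · apply List.sum_flatMap_range_ite _ (i - 1).toNat (r + i).toNat <;>
      simp only [DnLabel.V.injEq] <;> omega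
  all_goals exact (List.sum_flatMap_range_ite (P := False) _ 0 0 (by simp) (by simp)).trans (by simp)

lemma sum_Lam_arrows {n : ℕ} {u v : DnLabel} (hu : u.valid n) (hv : v.valid n) :
    ((List.range n).flatMap fun i0 => (List.range (2 * i0 + 2)).map fun k =>
      if Lam n ((i0 : ℤ) + 1) (-((i0 : ℤ) + 1) + (k : ℕ)) = u ∧
        Lam n ((i0 : ℤ) + 1) (-((i0 : ℤ) + 1) + (k : ℕ) + 1) = v then (2 : ℤ) else 0).sum =
    match u, v with
    | .V i r, .V j s =>
      if (j = i - 1 ∧ s = r ∧ r < 0) ∨ (j = i + 1 ∧ s = r ∧ 0 < r) then 2 else 0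
    | .V i r, .C a => if i = n ∧ r = n + 1 - a then 2 else 0
    | .C a, .V j s => if j = n ∧ s = a - n - 1 then 2 else 0
    | .C _, .C _ => 0 := by
  rcases u with ⟨i, r⟩ | a <;> rcases v with ⟨j, s⟩ | b <;> simp only [DnLabel.valid] at hu hv
  · apply List.sum_flatMap_range_ite _ (if r < 0 then n + r else n - r).toNat
      (if r < 0 then 2 * n + 2 + r - i else i - r).toNat
    · intro x hx k hk
      rw [Lam_eq_V_iff (by omega), Lam_eq_V_iff (by omega)]
      split_ifs <;> omega
    · intro h
      rw [Lam_eq_V_iff (by split_ifs <;> omega), Lam_eq_V_iff (by split_ifs <;> omega)]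
      split_ifs <;> omega
  · apply List.sum_flatMap_range_ite _ (b - 1).toNat (b - 1).toNat
    · intro x hx k hk
      rw [Lam_eq_V_iff (by omega), Lam_eq_C_iff]
      omega
    · intro h
      rw [Lam_eq_V_iff (by omega), Lam_eq_C_iff]
      omega
  · apply List.sum_flatMap_range_ite _ (a - 1).toNat a.toNat
    · intro x hx k hk
      rw [Lam_eq_V_iff (by omega), Lam_eq_C_iff]
      omega
    · intro h
      rw [Lam_eq_V_iff (by omega), Lam_eq_C_iff]
      omega
  · refine (List.sum_flatMap_range_ite (P := False) _ 0 0 (fun x hx k hk => ?_)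
      (by simp)).trans (by simp)
    rw [Lam_eq_C_iff, Lam_eq_C_iff]
    omega

lemma sum_left_boundary_arrows {n : ℕ} {u v : DnLabel} (hu : u.valid n) (hv : v.valid n) :
    ((List.range (n - 1)).map fun i0 : ℕ =>
      if DnLabel.V ((i0 : ℤ) + 1) (-((i0 : ℤ) + 1)) = u ∧
        DnLabel.V ((i0 : ℤ) + 2) (-((i0 : ℤ) + 2)) = v then (1 : ℤ) else 0).sum =
    match u, v with
    | .V i r, .V j s => if j = i + 1 ∧ r = -i ∧ s = -j then 1 else 0
    | _, _ => 0 := by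
  rcases u with ⟨i, r⟩ | a <;> rcases v with ⟨j, s⟩ | b <;> simp only [DnLabel.valid] at hu hv
  · apply List.sum_map_range_ite _ (i - 1).toNat <;> simp only [DnLabel.V.injEq] <;> omega
  all_goals simp

lemma sum_right_boundary_arrows {n : ℕ} {u v : DnLabel} (hu : u.valid n) (hv : v.valid n) :
    ((List.range (n - 1)).map fun i0 : ℕ =>
      if DnLabel.V ((i0 : ℤ) + 2) ((i0 : ℤ) + 2) = u ∧
        DnLabel.V ((i0 : ℤ) + 1) ((i0 : ℤ) + 1) = v then (1 : ℤ) else 0).sum =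
    match u, v with
    | .V i r, .V j s => if j = i - 1 ∧ r = i ∧ s = j then 1 else 0
    | _, _ => 0 := by
  rcases u with ⟨i, r⟩ | a <;> rcases v with ⟨j, s⟩ | b <;> simp only [DnLabel.valid] at hu hv
  · apply List.sum_map_range_ite _ (j - 1).toNat <;> simp only [DnLabel.V.injEq] <;> omega
  all_goals simp

lemma sum_descending_arrows {n : ℕ} {u v : DnLabel} (hu : u.valid n) (hv : v.valid n) :
    ((List.range (n - 1)).flatMap fun i0 : ℕ => (List.range (n - 1 - i0)).map fun k : ℕ =>
      if DnLabel.V ((i0 : ℤ) + 1 + k) (-(k : ℤ)) = u ∧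
        DnLabel.V ((i0 : ℤ) + 2 + k) (-(k : ℤ) - 1) = v then (2 : ℤ) else 0).sum =
    match u, v with
    | .V i r, .V j s => if j = i + 1 ∧ s = r - 1 ∧ r ≤ 0 ∧ -i < r then 2 else 0
    | _, _ => 0 := by
  rcases u with ⟨i, r⟩ | a <;> rcases v with ⟨j, s⟩ | b <;> simp only [DnLabel.valid] at hu hv
  · apply List.sum_flatMap_range_ite _ (i + r - 1).toNat (-r).toNat <;>
      simp only [DnLabel.V.injEq] <;> omega
  all_goals exact (List.sum_flatMap_range_ite (P := False) _ 0 0 (by simp) (by simp)).trans (by simp)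

lemma sum_ascending_arrows {n : ℕ} {u v : DnLabel} (hu : u.valid n) (hv : v.valid n) :
    ((List.range (n - 1)).flatMap fun i0 : ℕ => (List.range (n - 1 - i0)).map fun k : ℕ =>
      if DnLabel.V ((i0 : ℤ) + 2 + k) ((k : ℤ) + 1) = u ∧
        DnLabel.V ((i0 : ℤ) + 1 + k) (k : ℤ) = v then (2 : ℤ) else 0).sum =
    match u, v with
    | .V i r, .V j s => if j = i - 1 ∧ s = r - 1 ∧ 0 ≤ s ∧ s < j then 2 else 0
    | _, _ => 0 := by
  rcases u with ⟨i, r⟩ | a <;> rcases v with ⟨j, s⟩ | b <;> simp only [DnLabel.valid] at hu hv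
  · apply List.sum_flatMap_range_ite _ (j - s - 1).toNat s.toNat <;>
      simp only [DnLabel.V.injEq] <;> omega
  all_goals exact (List.sum_flatMap_range_ite (P := False) _ 0 0 (by simp) (by simp)).trans (by simp)

lemma sum_arrows_to_center {n : ℕ} {u v : DnLabel} (hu : u.valid n) (hv : v.valid n) :
    ((List.range (n - 1)).map fun i0 : ℕ =>
      if DnLabel.V (n : ℤ) ((i0 : ℤ) + 1 - n) = u ∧
        DnLabel.C ((i0 : ℤ) + 1) = v then (2 : ℤ) else 0).sum =
    match u, v with
    | .V i r, .C a => if a < n ∧ i = n ∧ r = a - n then 2 else 0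
    | _, _ => 0 := by
  rcases u with ⟨i, r⟩ | a <;> rcases v with ⟨j, s⟩ | b <;> simp only [DnLabel.valid] at hu hv
  case V.C =>
    apply List.sum_map_range_ite _ (b - 1).toNat <;>
      simp only [DnLabel.V.injEq, DnLabel.C.injEq] <;> omega
  all_goals simp

lemma sum_arrows_from_center {n : ℕ} {u v : DnLabel} (hu : u.valid n) (hv : v.valid n) :
    ((List.range (n - 1)).map fun i0 : ℕ =>
      if DnLabel.C ((i0 : ℤ) + 1) = u ∧
        DnLabel.V (n : ℤ) ((n : ℤ) - (i0 + 1)) = v then (2 : ℤ) else 0).sum =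
    match u, v with
    | .C a, .V j s => if a < n ∧ j = n ∧ s = n - a then 2 else 0
    | _, _ => 0 := by
  rcases u with ⟨i, r⟩ | a <;> rcases v with ⟨j, s⟩ | b <;> simp only [DnLabel.valid] at hu hv
  case C.V =>
    apply List.sum_map_range_ite _ (a - 1).toNat <;>
      simp only [DnLabel.V.injEq, DnLabel.C.injEq] <;> omega
  all_goals simp

lemma sum_flatMap_append {ι : Type*} (l : List ι) (f g : ι → List ℤ) :
    (l.flatMap fun x => f x ++ g x).sum = (l.flatMap f).sum + (l.flatMap g).sum := by
  induction l with
  | nil => rfl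
  | cons a l ih =>
    simp only [List.flatMap_cons, List.sum_append, ih]
    ring

lemma arrowWeight_eq {n : ℕ} {u v : DnLabel} (hu : u.valid n) (hv : v.valid n) :
    arrowWeight n u v = arrowForm n u v := by
  have hc (f g : ℕ → ℤ) (l : List ℕ) :
      (l.flatMap fun x => [f x, g x]).sum = (l.map f).sum + (l.map g).sum := by
    induction l with
    | nil => rfl
    | cons a l ih =>
      simp only [List.flatMap_cons, List.sum_append, ih, List.map_cons, List.sum_cons,
        List.sum_nil]
      ring
  unfold arrowWeight dnArrows
  simp only [List.map_append, List.sum_append, List.map_flatMap, List.map_map, Function.comp_def,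
    List.map_cons, List.map_nil, sum_flatMap_append, hc, bind_pure_comp, List.map_eq_map]
  rw [sum_horizontal_arrows hu hv, sum_Lam_arrows hu hv, sum_left_boundary_arrows hu hv,
    sum_right_boundary_arrows hu hv, sum_descending_arrows hu hv, sum_ascending_arrows hu hv,
    sum_arrows_to_center hu hv, sum_arrows_from_center hu hv]
  rcases u with ⟨i, r⟩ | a <;> rcases v with ⟨j, s⟩ | b <;> simp only [arrowForm] <;> ring

lemma eps2_eq {n : ℕ} {u v : DnLabel} (hu : u.valid n) (hv : v.valid n) :
    eps2 n u v = arrowForm n u v - arrowForm n v u := by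
  rw [eps2_eq_sub, arrowWeight_eq hu hv, arrowWeight_eq hv hu]

/-! ### `q`-commuting elements and path products -/

/-- `x y = q^e y x`. -/
def QComm {A : Type*} [Ring A] [Algebra Kq A] (e : ℤ) (x y : A) : Prop :=
  x * y = qq ^ e • (y * x)

lemma qq_ne_zero : qq ≠ 0 := RatFunc.X_ne_zero

namespace QComm

variable {A : Type*} [Ring A] [Algebra Kq A] {e f : ℤ} {x y z : A}

lemma symm (h : QComm e x y) : QComm (-e) y x := by
  unfold QComm at *
  rw [h, smul_smul, ← zpow_add₀ qq_ne_zero, neg_add_cancel, zpow_zero, one_smul]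

lemma one_left (y : A) : QComm 0 1 y := by simp [QComm]

lemma one_right (x : A) : QComm 0 x 1 := by simp [QComm]

lemma mul_left (hx : QComm e x z) (hy : QComm f y z) : QComm (e + f) (x * y) z := by
  unfold QComm at *
  rw [mul_assoc, hy, mul_smul_comm, ← mul_assoc, hx, smul_mul_assoc, smul_smul, mul_assoc,
    ← zpow_add₀ qq_ne_zero, add_comm]

lemma mul_right (hx : QComm e z x) (hy : QComm f z y) : QComm (e + f) z (x * y) := by
  simpa [add_comm] using (hx.symm.mul_left hy.symm).symm

lemma smul_left (h : QComm e x y) (c : Kq) : QComm e (c • x) y := by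
  unfold QComm at *
  rw [smul_mul_assoc, mul_smul_comm, h, smul_comm]

lemma smul_right (h : QComm e x y) (c : Kq) : QComm e x (c • y) := by
  unfold QComm at *
  rw [smul_mul_assoc, mul_smul_comm, h, smul_comm]

lemma sum_right {ι : Type*} {s : Finset ι} {t : ι → A} (h : ∀ k ∈ s, QComm e x (t k)) :
    QComm e x (∑ k ∈ s, t k) := by
  unfold QComm at *
  rw [Finset.mul_sum, Finset.sum_mul, Finset.smul_sum]
  exact Finset.sum_congr rfl h

lemma sum_left {ι : Type*} {s : Finset ι} {t : ι → A} (h : ∀ k ∈ s, QComm e (t k) x) :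
    QComm e (∑ k ∈ s, t k) x := by
  simpa using (sum_right fun k hk => (h k hk).symm).symm

lemma mul_comm (h : QComm 0 x y) : x * y = y * x := by simpa [QComm] using h

end QComm

lemma qComm_Xg {n : ℕ} {u v : DnLabel} (hu : u.valid n) (hv : v.valid n) :
    QComm (eps2 n v u) (Xg n u) (Xg n v) := by
  unfold QComm Xg
  rw [dif_pos hu, dif_pos hv, ← map_mul, ← map_mul, ← map_smul]
  exact RingQuot.mkAlgHom_rel Kq (DnRel.comm ⟨u, hu⟩ ⟨v, hv⟩)

lemma isUnit_Xg (n : ℕ) (v : DnLabel) : IsUnit (Xg n v) := by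
  by_cases hv : v.valid n
  · refine ⟨⟨Xg n v, Xinv n v, ?_, ?_⟩, rfl⟩ <;>
      unfold Xg Xinv <;> rw [dif_pos hv, dif_pos hv, ← map_mul, ← map_one (RingQuot.mkAlgHom Kq (DnRel n))]
    · exact RingQuot.mkAlgHom_rel Kq (DnRel.mul_inv ⟨v, hv⟩)
    · exact RingQuot.mkAlgHom_rel Kq (DnRel.inv_mul ⟨v, hv⟩)
  · simp [Xg, hv]

/-- The ordered product `X_{L(−i)} X_{L(1−i)} ⋯ X_{L(r)}`. -/
def pathProd (n : ℕ) (L : ℤ → DnLabel) (i r : ℤ) : Dtorus n :=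
  ((List.range (r + i + 1).toNat).map fun k => Xg n (L (-i + k))).prod

section pathProd

variable {n : ℕ} {L M : ℤ → DnLabel} {i j r s : ℤ}

lemma pathProd_empty (n : ℕ) (L : ℤ → DnLabel) (i : ℤ) : pathProd n L i (-i - 1) = 1 := by
  rw [pathProd, show (-i - 1 + i + 1).toNat = 0 by omega]
  rfl

lemma pathProd_add_one (h : -i - 1 ≤ r) :
    pathProd n L i (r + 1) = pathProd n L i r * Xg n (L (r + 1)) := by
  unfold pathProd
  simp only [bind_pure_comp, List.map_eq_map, List.map_map, Function.comp_def]
  rw [show (r + 1 + i + 1).toNat = (r + i + 1).toNat + 1 by omega, List.range_succ,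
    List.map_append, List.prod_append, List.map_singleton, List.prod_singleton]
  congr 3
  omega

lemma pathProd_neg (n : ℕ) (L : ℤ → DnLabel) (i : ℤ) : pathProd n L i (-i) = Xg n (L (-i)) := by
  have := pathProd_add_one (n := n) (L := L) (i := i) le_rfl
  rwa [pathProd_empty, one_mul, sub_add_cancel] at this

lemma isUnit_pathProd (n : ℕ) (L : ℤ → DnLabel) (i r : ℤ) : IsUnit (pathProd n L i r) := by
  unfold pathProd
  refine List.prod_induction IsUnit (fun _ _ => IsUnit.mul) isUnit_one ?_
  simp only [List.mem_map]
  rintro _ ⟨k, _, rfl⟩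
  exact isUnit_Xg n _

/-- Two path products `q`-commute with exponent `f r s` as soon as the exchange matrix is the mixed
second difference of `f`. -/
lemma qComm_pathProd (f : ℤ → ℤ → ℤ)
    (hL : ∀ r, -i ≤ r → r ≤ i → (L r).valid n) (hM : ∀ s, -j ≤ s → s ≤ j → (M s).valid n)
    (hf : ∀ s, f (-i - 1) s = 0) (hf' : ∀ r, f r (-j - 1) = 0)
    (heps : ∀ r s, -i ≤ r → r ≤ i → -j ≤ s → s ≤ j →
      eps2 n (M s) (L r) = f r s - f (r - 1) s - f r (s - 1) + f (r - 1) (s - 1))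
    (hr : -i - 1 ≤ r) (hr' : r ≤ i) (hs : -j - 1 ≤ s) (hs' : s ≤ j) :
    QComm (f r s) (pathProd n L i r) (pathProd n M j s) := by
  have step : ∀ s, -j ≤ s → s ≤ j → ∀ r, -i - 1 ≤ r → r ≤ i →
      QComm (f r s - f r (s - 1)) (pathProd n L i r) (Xg n (M s)) := by
    intro s hs hs' r hr
    induction r, hr using Int.leInduction with
    | base =>
      intro _
      rw [hf, hf, sub_zero, pathProd_empty]
      exact QComm.one_left _
    | succ r hr ih =>
      intro hr'
      rw [pathProd_add_one hr]
      convert (ih (by omega)).mul_left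
        (qComm_Xg (hL (r + 1) (by omega) hr') (hM s hs hs')) using 1
      have := heps (r + 1) s (by omega) hr' hs hs'
      rw [add_sub_cancel_right] at this
      omega
  induction s, hs using Int.leInduction with
  | base =>
    rw [hf', pathProd_empty]
    exact QComm.one_right _
  | succ s hs ih =>
    rw [pathProd_add_one hs]
    convert (ih (by omega)).mul_right (step (s + 1) (by omega) hs' r hr hr') using 1
    rw [add_sub_cancel_right]
    omega

end pathProd

lemma valid_V {n : ℕ} {i r : ℤ} (hi : 1 ≤ i) (hi' : i ≤ n) (hr : -i ≤ r) (hr' : r ≤ i) :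
    (DnLabel.V i r).valid n := ⟨hi, hi', hr, hr'⟩

lemma valid_Lam {n : ℕ} {i r : ℤ} (hi : 1 ≤ i) (hi' : i ≤ n) (hr : -i ≤ r) (hr' : r ≤ i) :
    (Lam n i r).valid n := by
  unfold Lam th
  split_ifs <;> simp only [DnLabel.valid] <;> omega

lemma eps2_Lam {n : ℕ} {i r j s : ℤ} (hi : 1 ≤ i) (hi' : i ≤ n) (hr : -i ≤ r) (hr' : r ≤ i)
    (hj : 1 ≤ j) (hj' : j ≤ n) (hs : -j ≤ s) (hs' : s ≤ j) :
    eps2 n (Lam n i r) (Lam n j s) = eps2 n (.V i r) (.V j s) := by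
  rw [eps2_eq (valid_Lam hi hi' hr hr') (valid_Lam hj hj' hs hs'),
    eps2_eq (valid_V hi hi' hr hr') (valid_V hj hj' hs hs')]
  unfold Lam th
  rcases (by omega : j = i ∨ j = i + 1 ∨ j = i - 1 ∨ (j ≠ i ∧ j ≠ i + 1 ∧ j ≠ i - 1)) with
      hji | hji | hji | hji <;>
  rcases (by omega : s = r ∨ s = r + 1 ∨ s = r - 1 ∨ (s ≠ r ∧ s ≠ r + 1 ∧ s ≠ r - 1)) with
      hsr | hsr | hsr | hsr <;>
  rcases lt_trichotomy r 0 with h | h | h <;> rcases lt_trichotomy s 0 with h' | h' | h' <;>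
  first
  | (exfalso; omega)
  | (simp (disch := omega) only [arrowForm, if_neg, if_pos, add_zero, zero_add]
     first | done | omega)
/-! ### Commutation exponents of path products -/

/-- The exponent with which the path products `X_{V_{i,−i}} ⋯ X_{V_{i,r}}` and
`X_{V_{j,−j}} ⋯ X_{V_{j,s}}` `q`-commute, for `i ≤ j`. -/
def pathForm (i j r s : ℤ) : ℤ :=
  if r = -i - 1 ∨ s = -j - 1 then 0
  else if j = i then (if r < s then -2 else if s < r then 2 else 0)
  else if j = i + 1 then
    (if r = i then (if s = j then 0 else -1) else if r < s ∨ (r = s ∧ r < 0) then 1 else -1)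
  else 0

lemma eps2_V_V {n : ℕ} {i r j s : ℤ} (hi : 1 ≤ i) (hij : i ≤ j) (hj : j ≤ n)
    (hr : -i ≤ r) (hr' : r ≤ i) (hs : -j ≤ s) (hs' : s ≤ j) :
    eps2 n (.V j s) (.V i r) = pathForm i j r s - pathForm i j (r - 1) s - pathForm i j r (s - 1)
      + pathForm i j (r - 1) (s - 1) := by
  rw [eps2_eq (valid_V (by omega) hj hs hs') (valid_V hi (by omega) hr hr')]
  rcases (by omega : j = i ∨ j = i + 1 ∨ i + 1 < j) with hji | hji | hji
  · subst hji
    simp (disch := omega) only [pathForm, arrowForm, if_neg, if_true, true_and, add_zero]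
    rcases (by omega : r = -j ∨ -j < r) with h | h <;>
    rcases (by omega : s = -j ∨ -j < s) with h' | h' <;>
    (try simp (disch := omega) only [if_neg, if_pos]) <;>
    omega
  · subst hji
    simp (disch := omega) only [pathForm, arrowForm, if_neg, if_true, true_and, add_zero, zero_add]
    rcases (by omega : r = -i ∧ r < i ∨ (-i < r ∧ r < i) ∨ r = i) with h | h | h <;>
    rcases (by omega : s = -(i + 1) ∨ (-(i + 1) < s ∧ s < i + 1) ∨ s = i + 1) with h' | h' | h' <;>
    simp (disch := omega) only [if_neg, if_pos] <;>
    omega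
  · simp (disch := omega) only [pathForm, arrowForm, if_neg, add_zero, ite_self]
    rfl

/-- The exponent with which the path products `X_{V_{i,−i}} ⋯ X_{V_{i,r}}` and
`X_{Λ_{a,−a}} ⋯ X_{Λ_{a,s}}` `q`-commute. -/
def crossForm (n i a r s : ℤ) : ℤ :=
  if r = -i - 1 ∨ s = -a - 1 then 0
  else if r = i then (if s = a then 0 else -cartanA i (n + 1 - a))
  else if s = a then cartanA i (n + 1 - a)
  else if r = -(n + 1 - a) - 1 ∧ s = n + 1 - i then -2
  else if r = -(n + 1 - a) ∧ s = n - i then 2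
  else if r = n - a ∧ s = -(n + 1 - i) then -2
  else if r = n + 1 - a ∧ s = -(n + 1 - i) - 1 then 2
  else 0

lemma eps2_Lam_V_of_pos {n : ℕ} {i r a s : ℤ} (hi : 1 ≤ i) (hi' : i ≤ n) (ha : 1 ≤ a) (ha' : a ≤ n)
    (hr : -i ≤ r) (hr' : r ≤ i) (hs : 0 < s) (hs' : s ≤ a) :
    eps2 n (Lam n a s) (.V i r) = crossForm n i a r s - crossForm n i a (r - 1) s
      - crossForm n i a r (s - 1) + crossForm n i a (r - 1) (s - 1) := by
  rw [eps2_eq (valid_Lam (by omega) ha' (by omega) hs') (valid_V hi (by omega) hr hr')]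
  obtain ⟨b, rfl⟩ : ∃ b, a = (n : ℤ) + 1 - b := ⟨n + 1 - a, by omega⟩
  obtain ⟨j, rfl⟩ : ∃ j, s = (n : ℤ) + 1 - j := ⟨n + 1 - s, by omega⟩
  have hbj : b ≤ j := by omega
  simp only [Lam, th, if_pos hs, crossForm, arrowForm, cartanA, sub_sub_cancel]
  rcases (by omega : j = b ∨ b < j) with h' | h' <;>
  rcases (by omega : r = i ∨ r = -i ∧ r < i ∨ (-i < r ∧ r < i)) with h | h | h <;>
  simp (disch := omega) only [if_neg, if_pos, add_zero] <;>
  rcases (by omega : j = i ∨ j = i + 1 ∨ j = i - 1 ∨ (j ≠ i ∧ j ≠ i + 1 ∧ j ≠ i - 1)) with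
      hji | hji | hji | hji <;>
  (try simp (disch := omega) only [if_neg, if_pos, add_zero]) <;>
  omega

lemma eps2_Lam_V_of_neg {n : ℕ} {i r a s : ℤ} (hi : 1 ≤ i) (hi' : i ≤ n) (ha : 1 ≤ a) (ha' : a ≤ n)
    (hr : -i ≤ r) (hr' : r ≤ i) (hs : -a ≤ s) (hs' : s < 0) :
    eps2 n (Lam n a s) (.V i r) = crossForm n i a r s - crossForm n i a (r - 1) s
      - crossForm n i a r (s - 1) + crossForm n i a (r - 1) (s - 1) := by
  rw [eps2_eq (valid_Lam (by omega) ha' (by omega) (by omega)) (valid_V hi (by omega) hr hr')]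
  obtain ⟨b, rfl⟩ : ∃ b, a = (n : ℤ) + 1 - b := ⟨n + 1 - a, by omega⟩
  obtain ⟨j, rfl⟩ : ∃ j, s = -((n : ℤ) + 1 - j) := ⟨n + 1 + s, by omega⟩
  have hbj : b ≤ j := by omega
  simp only [Lam, th, if_neg hs'.not_gt, if_pos hs', crossForm, arrowForm, cartanA,
    sub_sub_cancel, neg_neg]
  rcases (by omega : j = b ∨ b < j) with h' | h' <;>
  rcases (by omega : r = i ∨ r = -i ∧ r < i ∨ (-i < r ∧ r < i)) with h | h | h <;>
  simp (disch := omega) only [if_neg, if_pos, add_zero] <;>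
  rcases (by omega : j = i ∨ j = i + 1 ∨ j = i - 1 ∨ (j ≠ i ∧ j ≠ i + 1 ∧ j ≠ i - 1)) with
      hji | hji | hji | hji <;>
  (try simp (disch := omega) only [if_neg, if_pos, add_zero]) <;>
  omega

lemma eps2_Lam_V {n : ℕ} {i r a s : ℤ} (hi : 1 ≤ i) (hi' : i ≤ n) (ha : 1 ≤ a) (ha' : a ≤ n)
    (hr : -i ≤ r) (hr' : r ≤ i) (hs : -a ≤ s) (hs' : s ≤ a) :
    eps2 n (Lam n a s) (.V i r) = crossForm n i a r s - crossForm n i a (r - 1) s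
      - crossForm n i a r (s - 1) + crossForm n i a (r - 1) (s - 1) := by
  rcases lt_trichotomy s 0 with h0 | rfl | h0
  · exact eps2_Lam_V_of_neg hi hi' ha ha' hr hr' hs h0
  · rw [eps2_eq (valid_Lam ha ha' (by omega) (by omega)) (valid_V hi hi' hr hr')]
    obtain ⟨b, rfl⟩ : ∃ b, a = (n : ℤ) + 1 - b := ⟨n + 1 - a, by omega⟩
    simp only [Lam, lt_irrefl, if_false, crossForm, arrowForm, sub_sub_cancel]
    generalize cartanA i b = c
    rcases (by omega : r = i ∨ r = -i ∧ r < i ∨ (-i < r ∧ r < i)) with h | h | h <;>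
    rcases (by omega : i = n ∨ i < n) with h' | h' <;>
    simp (disch := omega) only [if_neg, if_pos, add_zero] <;>
    omega
  · exact eps2_Lam_V_of_pos hi hi' ha ha' hr hr' h0 hs'

/-- A family of labelled vertices spanning the same quiver as the `V_{i,r}`. -/
structure IsPathFamily (n : ℕ) (L : ℤ → ℤ → DnLabel) : Prop where
  valid : ∀ {i r : ℤ}, 1 ≤ i → i ≤ n → -i ≤ r → r ≤ i → (L i r).valid n
  eps2_eq : ∀ {i r j s : ℤ}, 1 ≤ i → i ≤ n → -i ≤ r → r ≤ i → 1 ≤ j → j ≤ n → -j ≤ s → s ≤ j →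
    eps2 n (L i r) (L j s) = eps2 n (.V i r) (.V j s)

lemma isPathFamily_V (n : ℕ) : IsPathFamily n DnLabel.V where
  valid := valid_V
  eps2_eq _ _ _ _ _ _ _ _ := rfl

lemma isPathFamily_Lam (n : ℕ) : IsPathFamily n (Lam n) where
  valid := valid_Lam
  eps2_eq := eps2_Lam

/-- The monomial `𝐢 q^{i+r} X_{L(i,−i)} ⋯ X_{L(i,r)}`. -/
def pathMono (n : ℕ) (L : ℤ → ℤ → DnLabel) (i r : ℤ) : Dtorus n :=
  (ii * qq ^ (i + r)) • pathProd n (L i) i r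

/-- The image `Σ_{r=−i}^{i−1} 𝐢 q^{i+r} X_{L(i,−i)} ⋯ X_{L(i,r)}` of a Chevalley generator. -/
def pathSum (n : ℕ) (L : ℤ → ℤ → DnLabel) (i : ℤ) : Dtorus n :=
  ∑ r ∈ Finset.Icc (-i) (i - 1), pathMono n L i r

/-- The image `q^{2i} X_{L(i,−i)} ⋯ X_{L(i,i)}` of a Cartan generator. -/
def pathCartan (n : ℕ) (L : ℤ → ℤ → DnLabel) (i : ℤ) : Dtorus n :=
  qq ^ (2 * i) • pathProd n (L i) i i

lemma isUnit_pathCartan (n : ℕ) (L : ℤ → ℤ → DnLabel) (i : ℤ) : IsUnit (pathCartan n L i) := by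
  unfold pathCartan
  rw [Algebra.smul_def]
  exact ((zpow_ne_zero _ qq_ne_zero).isUnit.map (algebraMap Kq (Dtorus n))).mul
    (isUnit_pathProd n _ i i)

lemma pathMono_add_one {n : ℕ} {L : ℤ → ℤ → DnLabel} {i r : ℤ} (h : -i - 1 ≤ r) :
    pathMono n L i (r + 1) = qq • (pathMono n L i r * Xg n (L i (r + 1))) := by
  unfold pathMono
  rw [pathProd_add_one h, smul_mul_assoc, smul_smul, ← add_assoc, zpow_add_one₀ qq_ne_zero]
  congr 1
  ring

section

variable {n : ℕ} {i j a r s : ℤ}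

lemma IsPathFamily.qComm_pathProd {L : ℤ → ℤ → DnLabel} (hL : IsPathFamily n L) (hi : 1 ≤ i)
    (hij : i ≤ j) (hj : j ≤ n) (hr : -i ≤ r) (hr' : r ≤ i) (hs : -j ≤ s) (hs' : s ≤ j) :
    QComm (pathForm i j r s) (pathProd n (L i) i r) (pathProd n (L j) j s) := by
  refine _root_.qComm_pathProd (pathForm i j) (fun r => hL.valid hi (by omega))
    (fun s => hL.valid (by omega) hj) (fun s => if_pos (.inl rfl)) (fun r => if_pos (.inr rfl))
    (fun r s hr hr' hs hs' => ?_) (by omega) hr' (by omega) hs'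
  rw [hL.eps2_eq (by omega) hj hs hs' hi (by omega) hr hr', eps2_V_V hi hij hj hr hr' hs hs']

lemma qComm_pathProd_V_Lam (hi : 1 ≤ i) (hi' : i ≤ n) (ha : 1 ≤ a) (ha' : a ≤ n)
    (hr : -i - 1 ≤ r) (hr' : r ≤ i) (hs : -a - 1 ≤ s) (hs' : s ≤ a) :
    QComm (crossForm n i a r s) (pathProd n (.V i) i r) (pathProd n (Lam n a) a s) :=
  _root_.qComm_pathProd (crossForm n i a) (fun _ => valid_V hi hi') (fun _ => valid_Lam ha ha')
    (fun _ => if_pos (.inl rfl)) (fun _ => if_pos (.inr rfl))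
    (fun _ _ => eps2_Lam_V hi hi' ha ha') hr hr' hs hs'

end

/-! ### The Serre relations -/

lemma serre_of_commute_up_to_scalar {K A : Type*} [Field K] [Ring A] [Algebra K A] {q : K}
    (hq : q ≠ 0) {x x' y : A} (hx : x * y = q • (y * x)) (hx' : x' * y = q⁻¹ • (y * x'))
    (h : x * x' = (q ^ 2)⁻¹ • (x' * x)) :
    (x + x') * (x + x') * y + y * ((x + x') * (x + x')) =
      (q + q⁻¹) • ((x + x') * y * (x + x')) := by
  have key {z w : A} {c d : K} (hz : z * y = c • (y * z)) (hw : w * y = d • (y * w)) :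
      z * w * y = (c * d) • (y * (z * w)) := by
    rw [mul_assoc, hw, mul_smul_comm, ← mul_assoc, hz, smul_mul_assoc, smul_smul, mul_comm d,
      mul_assoc]
  simp only [add_mul, mul_add, key hx hx, key hx hx', key hx' hx, key hx' hx']
  simp only [hx, hx', smul_mul_assoc, mul_assoc, h, mul_smul_comm]
  match_scalars <;> field_simp <;> ring

section

variable {A : Type*} [Ring A] [Algebra Kq A]

lemma serre_of_qComm {x x' y : A} (hx : QComm 1 x y) (hx' : QComm (-1) x' y)
    (h : QComm (-2) x x') :
    (x + x') * (x + x') * y + y * ((x + x') * (x + x')) =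
      (qq + qq⁻¹) • ((x + x') * y * (x + x')) :=
  serre_of_commute_up_to_scalar qq_ne_zero (by simpa [QComm] using hx)
    (by simpa [QComm] using hx') (by unfold QComm at h; rwa [zpow_neg] at h)

lemma serre_of_qComm_sum {ι κ : Type*} [LinearOrder ι] (S : Finset ι) (T : Finset κ) (x : ι → A)
    (y : κ → A) (p : ι → κ → Prop) [∀ k, DecidablePred (p · k)]
    (hp : ∀ r r' k, p r k → ¬ p r' k → r < r')
    (hx : ∀ r ∈ S, ∀ r' ∈ S, r < r' → QComm (-2) (x r) (x r'))
    (hxy : ∀ r ∈ S, ∀ k ∈ T, QComm (if p r k then 1 else -1) (x r) (y k)) :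
    (∑ r ∈ S, x r) * (∑ r ∈ S, x r) * (∑ k ∈ T, y k)
        + (∑ k ∈ T, y k) * ((∑ r ∈ S, x r) * (∑ r ∈ S, x r)) =
      (qq + qq⁻¹) • ((∑ r ∈ S, x r) * (∑ k ∈ T, y k) * (∑ r ∈ S, x r)) := by
  rw [Finset.mul_sum T, Finset.sum_mul T, ← Finset.sum_add_distrib, Finset.mul_sum T,
    Finset.sum_mul T, Finset.smul_sum]
  refine Finset.sum_congr rfl fun k hk => ?_
  rw [← Finset.sum_filter_add_sum_filter_not S (p · k)]
  refine serre_of_qComm (QComm.sum_left fun r hr => ?_) (QComm.sum_left fun r hr => ?_)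
    (QComm.sum_left fun r hr => QComm.sum_right fun r' hr' => ?_)
  · rw [Finset.mem_filter] at hr
    simpa [hr.2] using hxy r hr.1 k hk
  · rw [Finset.mem_filter] at hr
    simpa [hr.2] using hxy r hr.1 k hk
  · rw [Finset.mem_filter] at hr hr'
    exact hx r hr.1 r' hr'.1 (hp r r' k hr.2 hr'.2)

end

namespace IsPathFamily

variable {n : ℕ} {L : ℤ → ℤ → DnLabel} {i j : ℤ}

lemma qComm_pathMono (hL : IsPathFamily n L) {r s : ℤ} (hi : 1 ≤ i) (hij : i ≤ j) (hj : j ≤ n)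
    (hr : r ∈ Finset.Icc (-i) (i - 1)) (hs : s ∈ Finset.Icc (-j) (j - 1)) :
    QComm (pathForm i j r s) (pathMono n L i r) (pathMono n L j s) := by
  rw [Finset.mem_Icc] at hr hs
  exact ((hL.qComm_pathProd hi hij hj hr.1 (by omega) hs.1 (by omega)).smul_left _).smul_right _

lemma qComm_pathMono_self (hL : IsPathFamily n L) {r s : ℤ} (hi : 1 ≤ i) (hi' : i ≤ n)
    (hr : r ∈ Finset.Icc (-i) (i - 1)) (hs : s ∈ Finset.Icc (-i) (i - 1)) (hrs : r < s) :
    QComm (-2) (pathMono n L i r) (pathMono n L i s) := by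
  convert hL.qComm_pathMono hi le_rfl hi' hr hs using 1
  rw [Finset.mem_Icc] at hr hs
  unfold pathForm
  split_ifs <;> omega

lemma qComm_pathMono_succ (hL : IsPathFamily n L) {r s : ℤ} (hi : 1 ≤ i) (hi' : i + 1 ≤ n)
    (hr : r ∈ Finset.Icc (-i) (i - 1)) (hs : s ∈ Finset.Icc (-(i + 1)) (i + 1 - 1)) :
    QComm (if r < s ∨ (r = s ∧ r < 0) then 1 else -1) (pathMono n L i r)
      (pathMono n L (i + 1) s) := by
  convert hL.qComm_pathMono hi (by omega) hi' hr hs using 1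
  rw [Finset.mem_Icc] at hr hs
  unfold pathForm
  split_ifs <;> omega

lemma serre_succ (hL : IsPathFamily n L) (hi : 1 ≤ i) (hi' : i + 1 ≤ n) :
    pathSum n L i * pathSum n L i * pathSum n L (i + 1)
        + pathSum n L (i + 1) * (pathSum n L i * pathSum n L i) =
      (qq + qq⁻¹) • (pathSum n L i * pathSum n L (i + 1) * pathSum n L i) :=
  serre_of_qComm_sum _ _ _ _ (fun r s => r < s ∨ (r = s ∧ r < 0)) (fun r r' s => by omega)
    (fun _ hr _ hr' h => hL.qComm_pathMono_self hi (by omega) hr hr' h)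
    (fun _ hr _ hs => hL.qComm_pathMono_succ hi hi' hr hs)

lemma serre_succ' (hL : IsPathFamily n L) (hi : 1 ≤ i) (hi' : i + 1 ≤ n) :
    pathSum n L (i + 1) * pathSum n L (i + 1) * pathSum n L i
        + pathSum n L i * (pathSum n L (i + 1) * pathSum n L (i + 1)) =
      (qq + qq⁻¹) • (pathSum n L (i + 1) * pathSum n L i * pathSum n L (i + 1)) := by
  refine serre_of_qComm_sum _ _ _ _ (fun s r => ¬ (r < s ∨ (r = s ∧ r < 0)))
    (fun s s' r => by omega)
    (fun _ hr _ hr' h => hL.qComm_pathMono_self (by omega) hi' hr hr' h)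
    (fun s hs r hr => ?_)
  convert (hL.qComm_pathMono_succ hi hi' hr hs).symm using 1
  split_ifs <;> simp_all

lemma serre (hL : IsPathFamily n L) (hi : 1 ≤ i) (hi' : i ≤ n) (hj : 1 ≤ j) (hj' : j ≤ n)
    (hij : (i - j).natAbs = 1) :
    pathSum n L i * pathSum n L i * pathSum n L j + pathSum n L j * (pathSum n L i * pathSum n L i) =
      (qq + qq⁻¹) • (pathSum n L i * pathSum n L j * pathSum n L i) := by
  obtain rfl | rfl : j = i + 1 ∨ i = j + 1 := by omega
  · exact hL.serre_succ hi hj'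
  · exact hL.serre_succ' hj hi'

lemma pathSum_mul_comm (hL : IsPathFamily n L) (hi : 1 ≤ i) (hi' : i ≤ n) (hj : 1 ≤ j) (hj' : j ≤ n)
    (hij : 1 < (i - j).natAbs) : pathSum n L i * pathSum n L j = pathSum n L j * pathSum n L i := by
  wlog h : i < j
  · exact (this hL hj hj' hi hi' (by omega) (by omega)).symm
  refine QComm.mul_comm (QComm.sum_left fun r hr => QComm.sum_right fun s hs => ?_)
  convert hL.qComm_pathMono hi h.le hj' hr hs using 1
  unfold pathForm
  split_ifs <;> omega

/-- `K_i` and `E_j` `q`-commute with exponent `a_{ij}`. -/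
lemma qComm_pathCartan_pathSum (hL : IsPathFamily n L) (hi : 1 ≤ i) (hi' : i ≤ n) (hj : 1 ≤ j)
    (hj' : j ≤ n) : QComm (cartanA i j) (pathCartan n L i) (pathSum n L j) := by
  refine QComm.sum_right fun s hs => ?_
  rw [Finset.mem_Icc] at hs
  refine (QComm.smul_left ?_ _).smul_right _
  rcases le_total i j with h | h
  · convert hL.qComm_pathProd hi h hj' (by omega) le_rfl hs.1 (by omega) using 1
    unfold cartanA pathForm
    split_ifs <;> omega
  · convert (hL.qComm_pathProd hj h hi' hs.1 (by omega) (by omega) le_rfl).symm using 1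
    unfold cartanA pathForm
    split_ifs <;> omega

lemma pathCartan_mul_comm (hL : IsPathFamily n L) (hi : 1 ≤ i) (hi' : i ≤ n) (hj : 1 ≤ j)
    (hj' : j ≤ n) : pathCartan n L i * pathCartan n L j = pathCartan n L j * pathCartan n L i := by
  wlog h : i ≤ j
  · exact (this hL hj hj' hi hi' (by omega)).symm
  refine QComm.mul_comm ((QComm.smul_left ?_ _).smul_right _)
  convert hL.qComm_pathProd hi h hj' (by omega) le_rfl (by omega) le_rfl using 1
  unfold pathForm
  split_ifs <;> omega

end IsPathFamily

/-! ### Relations between the `V`- and the `Λ`-paths -/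

lemma Lam_th_of_pos {n : ℕ} {a i : ℤ} (hi : i ≤ n) : Lam n a (th n i) = .V i (-th n a) := by
  unfold Lam th
  rw [if_pos (by omega)]
  congr 1
  omega

lemma Lam_neg_th {n : ℕ} {a i : ℤ} (hi : i ≤ n) : Lam n a (-th n i) = .V i (th n a) := by
  unfold Lam th
  rw [if_neg (by omega), if_pos (by omega)]
  congr 1
  omega

lemma commutator_add_commutator {A : Type*} [Ring A] [Algebra Kq A] {x y z : A}
    (hxz : QComm 0 x z) (hxzy : QComm (-2) x (z * y)) (hxyz : QComm 2 (x * y) z) :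
    x * (z * y) - z * y * x + (x * y * z - z * (x * y)) = 0 := by
  have h : x * y * z = z * y * x := by
    rw [hxyz, ← mul_assoc, ← hxz.mul_comm, mul_assoc, hxzy, smul_smul, ← zpow_add₀ qq_ne_zero]
    simp
  rw [h, ← mul_assoc, ← mul_assoc, hxz.mul_comm]
  abel

lemma qq_sub_inv_mul_qq : (qq - qq⁻¹) * qq = qq ^ (2 : ℤ) - 1 := by
  rw [sub_mul, inv_mul_cancel₀ qq_ne_zero, zpow_ofNat, sq]

lemma commutator_of_qComm_two {A : Type*} [Ring A] [Algebra Kq A] {x y k : A} (h : QComm 2 x y)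
    (hk : qq • (y * x) = -k) : x * y - y * x = -((qq - qq⁻¹) • k) := by
  rw [h, ← smul_neg, ← hk, smul_smul, qq_sub_inv_mul_qq, sub_smul, one_smul]

lemma commutator_of_qComm_neg_two {A : Type*} [Ring A] [Algebra Kq A] {x y k : A}
    (h : QComm (-2) x y) (hk : qq • (x * y) = -k) : x * y - y * x = (qq - qq⁻¹) • k := by
  rw [← neg_sub, commutator_of_qComm_two h.symm hk, neg_neg]

lemma ii_mul_ii : ii * ii = -1 := by
  unfold ii
  rw [← map_mul, Complex.I_mul_I, map_neg, map_one]

lemma smul_ii_smul_mul_ii_smul {A : Type*} [Ring A] [Algebra Kq A] (c : Kq) (x y : A) :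
    qq • ((ii * c) • x * (ii • y)) = -((c * qq) • (x * y)) := by
  rw [mul_smul_comm, smul_mul_assoc, smul_smul, smul_smul, ← neg_smul]
  congr 1
  linear_combination qq * c * ii_mul_ii

section

variable {n : ℕ} {i a r s : ℤ}

lemma qComm_pathMono_V_Lam (hi : 1 ≤ i) (hi' : i ≤ n) (ha : 1 ≤ a) (ha' : a ≤ n)
    (hr : -i ≤ r) (hr' : r ≤ i) (hs : -a ≤ s) (hs' : s ≤ a) :
    QComm (crossForm n i a r s) (pathMono n .V i r) (pathMono n (Lam n) a s) :=
  ((qComm_pathProd_V_Lam hi hi' ha ha' (by omega) hr' (by omega) hs').smul_left _).smul_right _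

lemma qComm_pathCartan_V_pathSum_Lam (hi : 1 ≤ i) (hi' : i ≤ n) (ha : 1 ≤ a) (ha' : a ≤ n) :
    QComm (-cartanA i (th n a)) (pathCartan n .V i) (pathSum n (Lam n) a) := by
  refine QComm.sum_right fun s hs => ?_
  rw [Finset.mem_Icc] at hs
  refine (QComm.smul_left ?_ _).smul_right _
  convert qComm_pathProd_V_Lam hi hi' ha ha' (by omega) le_rfl (by omega : -a - 1 ≤ s)
    (by omega) using 1
  unfold crossForm th
  rw [if_neg (by omega), if_pos rfl, if_neg (by omega)]

lemma qComm_pathCartan_Lam_pathSum_V (hi : 1 ≤ i) (hi' : i ≤ n) (ha : 1 ≤ a) (ha' : a ≤ n) :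
    QComm (-cartanA (th n a) i) (pathCartan n (Lam n) a) (pathSum n .V i) := by
  refine QComm.sum_right fun r hr => ?_
  rw [Finset.mem_Icc] at hr
  refine (QComm.smul_left ?_ _).smul_right _
  convert (qComm_pathProd_V_Lam hi hi' ha ha' (by omega : -i - 1 ≤ r) (by omega) (by omega)
    (le_refl a)).symm using 1
  unfold crossForm
  rw [if_neg (by omega), if_neg (by omega), if_pos rfl]
  unfold cartanA th
  split_ifs <;> omega

lemma pathCartan_V_Lam_mul_comm (hi : 1 ≤ i) (hi' : i ≤ n) (ha : 1 ≤ a) (ha' : a ≤ n) :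
    pathCartan n .V i * pathCartan n (Lam n) a = pathCartan n (Lam n) a * pathCartan n .V i := by
  refine QComm.mul_comm ((QComm.smul_left ?_ _).smul_right _)
  convert qComm_pathProd_V_Lam hi hi' ha ha' (by omega) le_rfl (by omega) le_rfl using 1
  unfold crossForm
  rw [if_neg (by omega), if_pos rfl, if_pos rfl]

/-- The commutator of a monomial in `E_i` with a monomial in `F_{θ(a)}`. -/
def monoCommutator (n : ℕ) (i a : ℤ) (p : ℤ × ℤ) : Dtorus n :=
  pathMono n .V i p.1 * pathMono n (Lam n) a p.2 - pathMono n (Lam n) a p.2 * pathMono n .V i p.1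

lemma pathSum_commutator_eq_sum :
    pathSum n .V i * pathSum n (Lam n) a - pathSum n (Lam n) a * pathSum n .V i =
      ∑ p ∈ Finset.Icc (-i) (i - 1) ×ˢ Finset.Icc (-a) (a - 1), monoCommutator n i a p := by
  unfold monoCommutator pathSum
  rw [Finset.sum_sub_distrib, Finset.sum_product, Finset.sum_product_right, ← Finset.sum_mul_sum,
    ← Finset.sum_mul_sum]

lemma monoCommutator_eq_zero (hi : 1 ≤ i) (hi' : i ≤ n) (ha : 1 ≤ a) (ha' : a ≤ n)
    (hr : r ∈ Finset.Icc (-i) (i - 1)) (hs : s ∈ Finset.Icc (-a) (a - 1))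
    (h₁ : ¬ (r = -th n a - 1 ∧ s = th n i)) (h₂ : ¬ (r = -th n a ∧ s = th n i - 1))
    (h₃ : ¬ (r = th n a - 1 ∧ s = -th n i)) (h₄ : ¬ (r = th n a ∧ s = -th n i - 1)) :
    monoCommutator n i a (r, s) = 0 := by
  rw [Finset.mem_Icc] at hr hs
  refine sub_eq_zero.2 (QComm.mul_comm ?_)
  convert qComm_pathMono_V_Lam hi hi' ha ha' hr.1 (by omega) hs.1 (by omega) using 1
  unfold crossForm
  unfold th at h₁ h₂ h₃ h₄
  split_ifs <;> omega

lemma monoCommutator_add_of_pathMono_eq {r s : ℤ} {v : DnLabel} (hi : 1 ≤ i) (hi' : i ≤ n)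
    (ha : 1 ≤ a) (ha' : a ≤ n) (hr : -i ≤ r) (hr' : r + 1 ≤ i) (hs : -a ≤ s) (hs' : s + 1 ≤ a)
    (hv : DnLabel.V i (r + 1) = v) (hv' : Lam n a (s + 1) = v)
    (h₀ : crossForm n i a r s = 0) (h₁ : crossForm n i a r (s + 1) = -2)
    (h₂ : crossForm n i a (r + 1) s = 2) :
    monoCommutator n i a (r, s + 1) + monoCommutator n i a (r + 1, s) = 0 := by
  have e₀ := qComm_pathMono_V_Lam hi hi' ha ha' hr (by omega) hs (by omega)
  have e₁ := qComm_pathMono_V_Lam hi hi' ha ha' hr (by omega) (by omega : -a ≤ s + 1) hs'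
  have e₂ := qComm_pathMono_V_Lam hi hi' ha ha' (by omega : -i ≤ r + 1) hr' hs (by omega)
  rw [h₀] at e₀
  rw [h₁, pathMono_add_one (L := Lam n) (by omega), hv', ← mul_smul_comm] at e₁
  rw [h₂, pathMono_add_one (L := DnLabel.V) (by omega), hv, ← mul_smul_comm] at e₂
  unfold monoCommutator
  rw [pathMono_add_one (L := Lam n) (by omega), hv', pathMono_add_one (L := DnLabel.V) (by omega),
    hv, ← mul_smul_comm, ← mul_smul_comm]
  exact commutator_add_commutator e₀ e₁ e₂

lemma pathSum_commutator_of_lt (hi : 1 ≤ i) (hi' : i ≤ n) (ha : 1 ≤ a) (ha' : a ≤ n)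
    (h : i < th n a) :
    pathSum n .V i * pathSum n (Lam n) a - pathSum n (Lam n) a * pathSum n .V i = 0 := by
  rw [pathSum_commutator_eq_sum]
  refine Finset.sum_eq_zero fun ⟨r, s⟩ hp => ?_
  obtain ⟨hr, hs⟩ := Finset.mem_product.1 hp
  refine monoCommutator_eq_zero hi hi' ha ha' hr hs ?_ ?_ ?_ ?_ <;>
    · rw [Finset.mem_Icc] at hr hs
      unfold th at *
      dsimp only at hr hs
      omega

lemma pathSum_commutator_of_gt (hi : 1 ≤ i) (hi' : i ≤ n) (ha : 1 ≤ a) (ha' : a ≤ n)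
    (h : th n a < i) :
    pathSum n .V i * pathSum n (Lam n) a - pathSum n (Lam n) a * pathSum n .V i = 0 := by
  have h₁ : monoCommutator n i a (-th n a - 1, th n i)
      + monoCommutator n i a (-th n a, th n i - 1) = 0 := by
    have := monoCommutator_add_of_pathMono_eq (v := .V i (-th n a)) (r := -th n a - 1)
      (s := th n i - 1) hi hi' ha ha'
    rw [sub_add_cancel, sub_add_cancel] at this
    refine this ?_ ?_ ?_ ?_ rfl (Lam_th_of_pos hi') ?_ ?_ ?_ <;> unfold th at * <;> try omega
    all_goals unfold crossForm; split_ifs <;> omega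
  have h₂ : monoCommutator n i a (th n a - 1, -th n i)
      + monoCommutator n i a (th n a, -th n i - 1) = 0 := by
    have := monoCommutator_add_of_pathMono_eq (v := .V i (th n a)) (r := th n a - 1)
      (s := -th n i - 1) hi hi' ha ha'
    rw [sub_add_cancel, sub_add_cancel] at this
    refine this ?_ ?_ ?_ ?_ rfl (Lam_neg_th hi') ?_ ?_ ?_ <;> unfold th at * <;> try omega
    all_goals unfold crossForm; split_ifs <;> omega
  have hth : 0 < th n a ∧ 0 < th n i ∧ th n i < a := by unfold th at *; omega
  rw [pathSum_commutator_eq_sum, ← Finset.sum_subset (s₁ := {(-th n a - 1, th n i),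
    (-th n a, th n i - 1), (th n a - 1, -th n i), (th n a, -th n i - 1)})]
  · rw [Finset.sum_insert, Finset.sum_insert, Finset.sum_pair, h₂, add_zero, h₁]
    all_goals
      simp only [Finset.mem_insert, Finset.mem_singleton, Prod.mk.injEq, ne_eq]
      omega
  · rintro ⟨r, s⟩ hp
    simp only [Finset.mem_insert, Finset.mem_singleton, Prod.mk.injEq] at hp
    simp only [Finset.mem_product, Finset.mem_Icc]
    omega
  · rintro ⟨r, s⟩ hp hp'
    obtain ⟨hr, hs⟩ := Finset.mem_product.1 hp
    simp only [Finset.mem_insert, Finset.mem_singleton, Prod.mk.injEq, not_or] at hp'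
    exact monoCommutator_eq_zero hi hi' ha ha' hr hs hp'.1 hp'.2.1 hp'.2.2.1 hp'.2.2.2

lemma pathMono_neg (n : ℕ) (L : ℤ → ℤ → DnLabel) (i : ℤ) :
    pathMono n L i (-i) = ii • Xg n (L i (-i)) := by
  rw [pathMono, pathProd_neg, add_neg_cancel, zpow_zero, mul_one]

lemma pathMono_sub_one_mul (n : ℕ) (L : ℤ → ℤ → DnLabel) {i : ℤ} (hi : 0 ≤ i) :
    qq • (pathMono n L i (i - 1) * (ii • Xg n (L i i))) = -pathCartan n L i := by
  unfold pathMono pathCartan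
  conv_rhs => rw [← sub_add_cancel i 1, pathProd_add_one (by omega), sub_add_cancel]
  rw [show 2 * i = i + (i - 1) + 1 by ring, zpow_add_one₀ qq_ne_zero]
  exact smul_ii_smul_mul_ii_smul _ _ _

lemma pathSum_commutator_of_eq (hi : 1 ≤ i) (hi' : i ≤ n) (ha : 1 ≤ a) (ha' : a ≤ n)
    (h : th n a = i) :
    pathSum n .V i * pathSum n (Lam n) a - pathSum n (Lam n) a * pathSum n .V i =
      (qq - qq⁻¹) • (pathCartan n .V i - pathCartan n (Lam n) a) := by
  have hth : th n i = a := by unfold th at *; omega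
  have h₁ : monoCommutator n i a (-i, a - 1) = -((qq - qq⁻¹) • pathCartan n (Lam n) a) := by
    have e := qComm_pathMono_V_Lam hi hi' ha ha' le_rfl (by omega) (by omega : -a ≤ a - 1)
      (by omega)
    rw [show crossForm n i a (-i) (a - 1) = 2 by
      unfold crossForm; unfold th at *; split_ifs <;> omega] at e
    have hL : Lam n a a = .V i (-i) := by rw [← h, ← hth, Lam_th_of_pos hi', hth, h]
    refine commutator_of_qComm_two e ?_
    rw [pathMono_neg n .V, ← hL, pathMono_sub_one_mul _ _ (by omega)]
  have h₂ : monoCommutator n i a (i - 1, -a) = (qq - qq⁻¹) • pathCartan n .V i := by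
    have e := qComm_pathMono_V_Lam hi hi' ha ha' (by omega : -i ≤ i - 1) (by omega) le_rfl
      (by omega)
    rw [show crossForm n i a (i - 1) (-a) = -2 by
      unfold crossForm; unfold th at *; split_ifs <;> omega] at e
    have hL : Lam n a (-a) = .V i i := by rw [← hth, Lam_neg_th hi', hth, h]
    refine commutator_of_qComm_neg_two e ?_
    rw [pathMono_neg n (Lam n), hL, pathMono_sub_one_mul _ _ (by omega)]
  rw [pathSum_commutator_eq_sum, ← Finset.sum_subset (s₁ := {(-i, a - 1), (i - 1, -a)})]
  · rw [Finset.sum_pair, h₁, h₂, smul_sub]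
    · abel
    · simp only [Prod.mk.injEq, ne_eq]
      omega
  · rintro ⟨r, s⟩ hp
    simp only [Finset.mem_insert, Finset.mem_singleton, Prod.mk.injEq] at hp
    simp only [Finset.mem_product, Finset.mem_Icc]
    omega
  · rintro ⟨r, s⟩ hp hp'
    obtain ⟨hr, hs⟩ := Finset.mem_product.1 hp
    simp only [Finset.mem_insert, Finset.mem_singleton, Prod.mk.injEq, not_or] at hp'
    refine monoCommutator_eq_zero hi hi' ha ha' hr hs ?_ ?_ ?_ ?_ <;>
    · rw [Finset.mem_Icc] at hr hs
      dsimp only at hr hs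
      omega

/-- `[E_i, F_j] = δ_{ij} (q - q⁻¹) (K_i - K_i')`. -/
lemma pathSum_V_mul_pathSum_Lam (hi : 1 ≤ i) (hi' : i ≤ n) (ha : 1 ≤ a) (ha' : a ≤ n) :
    pathSum n .V i * pathSum n (Lam n) a = pathSum n (Lam n) a * pathSum n .V i
      + (if i = th n a then qq - qq⁻¹ else 0) • (pathCartan n .V i - pathCartan n (Lam n) a) := by
  rw [← sub_eq_iff_eq_add']
  rcases lt_trichotomy i (th n a) with h | h | h
  · rw [if_neg h.ne, zero_smul, pathSum_commutator_of_lt hi hi' ha ha' h]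
  · rw [if_pos h, pathSum_commutator_of_eq hi hi' ha ha' h.symm]
  · rw [if_neg h.ne', zero_smul, pathSum_commutator_of_gt hi hi' ha ha' h]

end

/-! ### The homomorphism -/

lemma th_th (n : ℕ) (i : ℤ) : th n (th n i) = i := by
  unfold th
  omega

lemma cartanA_th_th (n : ℕ) (i j : ℤ) : cartanA (th n i) (th n j) = cartanA i j := by
  unfold cartanA th
  split_ifs <;> omega

/-- The images of the generators of `𝔇ₙ` in `𝒟ₙ`. -/
def iotaGen (n : ℕ) : DDGen n → Dtorus n
  | .E i => pathSum n .V i.1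
  | .F i => pathSum n (Lam n) (th n i.1)
  | .K i => pathCartan n .V i.1
  | .K' i => pathCartan n (Lam n) (th n i.1)
  | .Kinv i => Ring.inverse (pathCartan n .V i.1)
  | .K'inv i => Ring.inverse (pathCartan n (Lam n) (th n i.1))

/-- The extension of `iotaGen` to the free algebra. -/
def iotaFree (n : ℕ) : FreeAlgebra Kq (DDGen n) →ₐ[Kq] Dtorus n := FreeAlgebra.lift Kq (iotaGen n)

lemma iotaFree_ddg (n : ℕ) (g : DDGen n) : iotaFree n (ddg n g) = iotaGen n g :=
  FreeAlgebra.lift_ι_apply _ _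

lemma iotaFree_rel (n : ℕ) ⦃x y : FreeAlgebra Kq (DDGen n)⦄ (h : DDRel n x y) :
    iotaFree n x = iotaFree n y := by
  have hV := isPathFamily_V n
  have hΛ := isPathFamily_Lam n
  have hth (j : Idx n) : 1 ≤ th n j.1 ∧ th n j.1 ≤ n := (thIdx n j).2
  induction h <;>
    simp only [map_add, map_sub, map_mul, map_smul, map_one, iotaFree_ddg, iotaGen]
  case KE i j => exact hV.qComm_pathCartan_pathSum i.2.1 i.2.2 j.2.1 j.2.2
  case K'E i j =>
    simpa only [th_th, QComm] using
      qComm_pathCartan_Lam_pathSum_V j.2.1 j.2.2 (hth i).1 (hth i).2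
  case KF i j =>
    simpa only [th_th, QComm] using
      qComm_pathCartan_V_pathSum_Lam i.2.1 i.2.2 (hth j).1 (hth j).2
  case K'F i j =>
    rw [← cartanA_th_th n]
    exact hΛ.qComm_pathCartan_pathSum (hth i).1 (hth i).2 (hth j).1 (hth j).2
  case KK i j => exact hV.pathCartan_mul_comm i.2.1 i.2.2 j.2.1 j.2.2
  case KK' i j => exact pathCartan_V_Lam_mul_comm i.2.1 i.2.2 (hth j).1 (hth j).2
  case K'K' i j => exact hΛ.pathCartan_mul_comm (hth i).1 (hth i).2 (hth j).1 (hth j).2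
  case K_Kinv i => exact Ring.mul_inverse_cancel _ (isUnit_pathCartan n _ _)
  case Kinv_K i => exact Ring.inverse_mul_cancel _ (isUnit_pathCartan n _ _)
  case K'_K'inv i => exact Ring.mul_inverse_cancel _ (isUnit_pathCartan n _ _)
  case K'inv_K' i => exact Ring.inverse_mul_cancel _ (isUnit_pathCartan n _ _)
  case EF i j =>
    rw [pathSum_V_mul_pathSum_Lam i.2.1 i.2.2 (hth j).1 (hth j).2, th_th]
    split_ifs with h
    · rw [h]
    · rw [zero_smul, zero_smul]
  case serreE i j h => exact hV.serre i.2.1 i.2.2 j.2.1 j.2.2 h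
  case serreF i j h =>
    exact hΛ.serre (hth i).1 (hth i).2 (hth j).1 (hth j).2 (by unfold th; omega)
  case EEc i j h => exact hV.pathSum_mul_comm i.2.1 i.2.2 j.2.1 j.2.2 h
  case FFc i j h =>
    exact hΛ.pathSum_mul_comm (hth i).1 (hth i).2 (hth j).1 (hth j).2 (by unfold th; omega)

/-- The homomorphism `ι : 𝔇ₙ → 𝒟ₙ`. -/
def iota (n : ℕ) : DDalg n →ₐ[Kq] Dtorus n :=
  RingQuot.liftAlgHom Kq ⟨iotaFree n, iotaFree_rel n⟩

lemma iota_DDgen (n : ℕ) (g : DDGen n) : iota n (DDgen n g) = iotaGen n g := by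
  unfold iota DDgen
  rw [RingQuot.liftAlgHom_mkAlgHom_apply, iotaFree_ddg]

/-- The assignment `E_i ↦ Σ_{r=−i}^{i−1} w_i^r`,
`F_{θ(i)} ↦ Σ_{r=−i}^{i−1} m_i^r`, `K_i ↦ q^{2i} X_{V_{i,−i}} ⋯ X_{V_{i,i}}`,
`K'_{θ(i)} ↦ q^{2i} X_{Λ_{i,−i}} ⋯ X_{Λ_{i,i}}` (with `K_i^{−1}`, `(K_i')^{−1}` sent to the
inverses of the images of `K_i`, `K_i'`) extends to a homomorphism of
`𝕂`-algebras `ι : 𝔇ₙ → 𝒟ₙ`, i.e. the images satisfy all defining relations of `𝔇ₙ`. -/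
theorem statement1 (n : ℕ) (hn : 1 ≤ n) :
    ∃ f : DDalg n →ₐ[Kq] Dtorus n, iotaSpec n f := by
  refine ⟨iota n, fun i => ?_⟩
  simp only [iota_DDgen, iotaGen, thIdx, th_th]
  exact ⟨rfl, rfl, rfl, rfl, Ring.inverse_mul_cancel _ (isUnit_pathCartan n _ _),
    Ring.mul_inverse_cancel _ (isUnit_pathCartan n _ _),
    Ring.inverse_mul_cancel _ (isUnit_pathCartan n _ _),
    Ring.mul_inverse_cancel _ (isUnit_pathCartan n _ _)⟩

end
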